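/- arXiv:1805.00746 — 3 statements merged into one kernel-verified Lean document; each statement's English description precedes it below -/
import Mathlib

section
/- (Segre type [(15)]) Let n = 3 with coordinates (u¹,u²,u³), and let U = {u ∈ ℝ³ : u¹ + u² u³ + 2 (u³)³ > 0}. Define the symmetric metric g by g₁₁ = 0, g₁₂ = 1, g₁₃ = 2u³, g₂₂ = −2u³, g₂₃ = u², g₃₃ = −4u¹; then det g = 4u¹ + 4u²u³ + 8(u³)³ > 0 on U. Define c_{ijk} := (1/3)(∂_j g_{ik} − ∂_k g_{ij}) and the skew-symmetric field w by w₁₂ = 0, w₃₁ = −1/√(u¹ + u²u³ + 2(u³)³), w₂₃ = u³/√(u¹ + u²u³ + 2(u³)³) (with w_{ji} = −w_{ij}, w_{ii} = 0). Then (g, c, w) satisfies conditions (cond1) on U. -/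
open scoped BigOperators

/-- Partial derivative `∂_k f` in the `k`-th coordinate direction. -/
noncomputable def pd {n : ℕ} (k : Fin n) (f : (Fin n → ℝ) → ℝ) (u : Fin n → ℝ) : ℝ :=
  fderiv ℝ f u (Pi.single k 1)

/-- Conditions (cond1) for a triple `(g, c, w)` on a set `U ⊆ ℝⁿ`:
`g` is the (lower-index) metric `g_{ij}`, `c` are the lowered coefficients `c_{ijk}`,
`w` is the skew-symmetric 2-form `w_{ij}`, and `c^s_{jk} := g^{si} c_{ijk}` is computed
via the pointwise inverse matrix `(g u)⁻¹`. -/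
def Cond1 {n : ℕ} (U : Set (Fin n → ℝ))
    (g : (Fin n → ℝ) → Matrix (Fin n) (Fin n) ℝ)
    (c : (Fin n → ℝ) → Fin n → Fin n → Fin n → ℝ)
    (w : (Fin n → ℝ) → Matrix (Fin n) (Fin n) ℝ) : Prop :=
  ∀ u ∈ U,
    (∀ i j k, pd k (fun x => g x i j) u + c u i j k + c u j i k = 0) ∧
    (∀ i j k, c u i j k + c u i k j = 0) ∧
    (∀ i j k, pd k (fun x => g x i j) u + pd i (fun x => g x j k) u
        + pd j (fun x => g x k i) u = 0) ∧
    (∀ i j, w u i j + w u j i = 0) ∧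
    (∀ i j l, pd l (fun x => w x i j) u
        = ∑ s, (∑ a, (g u)⁻¹ s a * c u a i j) * w u s l) ∧
    (∀ m l p k, pd k (fun x => c x p m l) u
        + ∑ s, (∑ a, (g u)⁻¹ s a * c u a m l) * c u s p k + w u m l * w u p k = 0)

lemma pd_of_hasFDerivAt {n : ℕ} {k : Fin n} {f : (Fin n → ℝ) → ℝ} {u : Fin n → ℝ}
    {L : (Fin n → ℝ) →L[ℝ] ℝ} (h : HasFDerivAt f L u) : pd k f u = L (Pi.single k 1) := by
  rw [pd, h.fderiv]

lemma pd_const' {n : ℕ} (k : Fin n) (a : ℝ) (u : Fin n → ℝ) :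
    pd k (fun _ => a) u = 0 := by
  rw [pd_of_hasFDerivAt (hasFDerivAt_const a u)]; simp

lemma hasFDerivAt_coord {n : ℕ} (i : Fin n) (u : Fin n → ℝ) :
    HasFDerivAt (fun x : Fin n → ℝ => x i)
      (ContinuousLinearMap.proj (R := ℝ) (φ := fun _ : Fin n => ℝ) i) u :=
  hasFDerivAt_apply i u

lemma pd_coord {n : ℕ} (k i : Fin n) (u : Fin n → ℝ) :
    pd k (fun x => x i) u = (Pi.single k 1 : Fin n → ℝ) i := by
  rw [pd_of_hasFDerivAt (hasFDerivAt_coord i u)]; simp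

lemma pd_mul_coord {n : ℕ} (k i : Fin n) (a : ℝ) (u : Fin n → ℝ) :
    pd k (fun x => a * x i) u = a * (Pi.single k 1 : Fin n → ℝ) i := by
  rw [pd_of_hasFDerivAt ((hasFDerivAt_coord i u).const_mul a)]; simp

lemma pd_neg' {n : ℕ} (k : Fin n) (f : (Fin n → ℝ) → ℝ) (u : Fin n → ℝ) :
    pd k (fun x => -(f x)) u = - pd k f u := by
  simp [pd, fderiv_fun_neg]

/-- The table of first derivatives of the metric: `segDg k i j = ∂_k g_{ij}`. -/
def segDg : Fin 3 → Matrix (Fin 3) (Fin 3) ℝ :=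
  ![!![0, 0, 0; 0, 0, 0; 0, 0, -4],
    !![0, 0, 0; 0, 0, 1; 0, 1, 0],
    !![0, 0, 2; 0, -2, 0; 2, 0, 0]]

/-- The table of the (constant) coefficients `c_{ijk}`. -/
def segC : Fin 3 → Matrix (Fin 3) (Fin 3) ℝ :=
  ![0, !![0, 0, 0; 0, 0, 1; 0, -1, 0], !![0, 0, -2; 0, 0, 0; 2, 0, 0]]

/-- The metric. -/
def segG (u : Fin 3 → ℝ) : Matrix (Fin 3) (Fin 3) ℝ :=
  !![0, 1, 2 * u 2; 1, -(2 * u 2), u 1; 2 * u 2, u 1, -(4 * u 0)]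

lemma pd_segG (u : Fin 3 → ℝ) (i j k : Fin 3) :
    pd k (fun x => segG x i j) u = segDg k i j := by
  fin_cases i <;> fin_cases j <;> fin_cases k <;>
    simp [segG, segDg, pd_const', pd_coord, pd_mul_coord, pd_neg']

lemma segC_eq (i j k : Fin 3) : (1 / 3) * (segDg j i k - segDg k i j) = segC i j k := by
  fin_cases i <;> fin_cases j <;> fin_cases k <;> norm_num [segC, segDg]

lemma segG_inv (u : Fin 3 → ℝ) (h : 0 < u 0 + u 1 * u 2 + 2 * (u 2) ^ 3) :
    (segG u)⁻¹ = (4 * (u 0 + u 1 * u 2 + 2 * (u 2) ^ 3))⁻¹ •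
      !![8 * u 0 * u 2 - u 1 ^ 2, 4 * u 0 + 2 * u 1 * u 2, u 1 + 4 * u 2 ^ 2;
         4 * u 0 + 2 * u 1 * u 2, -(4 * u 2 ^ 2), 2 * u 2;
         u 1 + 4 * u 2 ^ 2, 2 * u 2, -1] := by
  apply Matrix.inv_eq_right_inv
  rw [Matrix.mul_smul, inv_smul_eq_iff₀ (by positivity)]
  ext i j
  fin_cases i <;> fin_cases j <;> simp [segG, Matrix.mul_apply, Fin.sum_univ_three] <;> ring

/-- The gradient of `S = u¹ + u²u³ + 2(u³)³`. -/
def segDS (u : Fin 3 → ℝ) : Fin 3 → ℝ := ![1, u 2, u 1 + 6 * u 2 ^ 2]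

lemma pd_w1 (u : Fin 3 → ℝ) (h : 0 < u 0 + u 1 * u 2 + 2 * (u 2) ^ 3) (k : Fin 3) (a b : ℝ) :
    pd k (fun x => (a + b * x 2) / Real.sqrt (x 0 + x 1 * x 2 + 2 * (x 2) ^ 3)) u =
      (b * (Pi.single k 1 : Fin 3 → ℝ) 2 * (u 0 + u 1 * u 2 + 2 * (u 2) ^ 3)
        - (a + b * u 2) * segDS u k / 2) /
      (Real.sqrt (u 0 + u 1 * u 2 + 2 * (u 2) ^ 3) * (u 0 + u 1 * u 2 + 2 * (u 2) ^ 3)) := by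
  have h0 := hasFDerivAt_coord 0 u
  have h1 := hasFDerivAt_coord 1 u
  have h2 := hasFDerivAt_coord 2 u
  have hS := ((h0.fun_add (h1.fun_mul h2)).fun_add ((h2.pow 3).const_mul 2)).sqrt h.ne'
  have hq : 0 < Real.sqrt (u 0 + u 1 * u 2 + 2 * (u 2) ^ 3) := Real.sqrt_pos.mpr h
  have hN := ((h2.const_mul b).const_add a).fun_mul
    ((hasDerivAt_inv hq.ne').comp_hasFDerivAt u hS)
  simp only [div_eq_mul_inv (_ + _ * _)]
  refine (pd_of_hasFDerivAt hN).trans ?_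
  simp only [Function.comp_apply]
  have hsq := Real.sq_sqrt h.le
  set q := Real.sqrt (u 0 + u 1 * u 2 + 2 * (u 2) ^ 3) with hqdef
  have hu0 : u 0 = q ^ 2 - u 1 * u 2 - 2 * u 2 ^ 3 := by linarith
  clear_value q
  rw [← hsq]
  fin_cases k <;> simp [segDS] <;> field_simp <;> ring

set_option maxHeartbeats 4000000 in
/-- Segre type [(15)]. With `(u¹,u²,u³) = (u 0, u 1, u 2)` and
`U = {u : u¹ + u²u³ + 2(u³)³ > 0}`, the indicated metric (with
`det g = 4u¹ + 4u²u³ + 8(u³)³ > 0` on `U`), `c_{ijk} = (1/3)(∂_j g_{ik} − ∂_k g_{ij})`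
and the skew form with `w₁₂ = 0`, `w₃₁ = −1/√(u¹+u²u³+2(u³)³)`,
`w₂₃ = u³/√(u¹+u²u³+2(u³)³)` satisfy conditions (cond1) on `U`. -/
theorem segre_15_satisfies_cond1
    (U : Set (Fin 3 → ℝ)) (hU : U = {u | 0 < u 0 + u 1 * u 2 + 2 * (u 2) ^ 3})
    (g : (Fin 3 → ℝ) → Matrix (Fin 3) (Fin 3) ℝ)
    (hg : g = fun u => !![0, 1, 2 * u 2;
                          1, -(2 * u 2), u 1;
                          2 * u 2, u 1, -(4 * u 0)])
    (c : (Fin 3 → ℝ) → Fin 3 → Fin 3 → Fin 3 → ℝ)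
    (hc : c = fun u i j k =>
      (1 / 3) * (pd j (fun x => g x i k) u - pd k (fun x => g x i j) u))
    (w : (Fin 3 → ℝ) → Matrix (Fin 3) (Fin 3) ℝ)
    (hw : w = fun u =>
      !![0, 0, 1 / Real.sqrt (u 0 + u 1 * u 2 + 2 * (u 2) ^ 3);
         0, 0, u 2 / Real.sqrt (u 0 + u 1 * u 2 + 2 * (u 2) ^ 3);
         -(1 / Real.sqrt (u 0 + u 1 * u 2 + 2 * (u 2) ^ 3)),
           -(u 2 / Real.sqrt (u 0 + u 1 * u 2 + 2 * (u 2) ^ 3)), 0]) :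
    (∀ u ∈ U, (g u).det = 4 * u 0 + 4 * u 1 * u 2 + 8 * (u 2) ^ 3 ∧ 0 < (g u).det) ∧
    Cond1 U g c w := by
  have hg' : g = segG := by rw [hg]; rfl
  subst hg'
  clear hg
  have hc' : c = fun _ i j k => segC i j k := by
    rw [hc]; funext u i j k; rw [pd_segG, pd_segG, segC_eq]
  subst hc'
  clear hc
  subst hU
  refine ⟨fun u hu => ?_, fun u hu => ?_⟩
  · have hdet : (segG u).det = 4 * u 0 + 4 * u 1 * u 2 + 8 * (u 2) ^ 3 := by
      simp [segG, Matrix.det_fin_three]; ring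
    refine ⟨hdet, ?_⟩
    have hu' : 0 < u 0 + u 1 * u 2 + 2 * (u 2) ^ 3 := hu
    rw [hdet]; linarith
  have hu' : 0 < u 0 + u 1 * u 2 + 2 * (u 2) ^ 3 := hu
  have hq : 0 < Real.sqrt (u 0 + u 1 * u 2 + 2 * (u 2) ^ 3) := Real.sqrt_pos.mpr hu'
  have hsq := Real.sq_sqrt hu'.le
  have hw1 := fun k => pd_w1 u hu' k 1 0
  have hw2 := fun k => pd_w1 u hu' k 0 1
  simp only [zero_mul, add_zero, zero_add, one_mul] at hw1 hw2
  have hinv := segG_inv u hu'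
  refine ⟨?_, ?_, ?_, ?_, ?_, ?_⟩
  · intro i j k
    rw [pd_segG]
    fin_cases i <;> fin_cases j <;> fin_cases k <;> norm_num [segC, segDg]
  · intro i j k
    fin_cases i <;> fin_cases j <;> fin_cases k <;> norm_num [segC]
  · intro i j k
    simp only [pd_segG]
    fin_cases i <;> fin_cases j <;> fin_cases k <;> norm_num [segDg]
  · intro i j
    subst hw
    fin_cases i <;> fin_cases j <;> simp
  · intro i j l
    rw [hinv]
    subst hw
    have hu0 : u 0 = Real.sqrt (u 0 + u 1 * u 2 + 2 * (u 2) ^ 3) ^ 2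
      - u 1 * u 2 - 2 * u 2 ^ 3 := by linarith
    fin_cases i <;> fin_cases j <;>
      simp only [Fin.zero_eta, Fin.mk_one, Fin.reduceFinMk, Matrix.of_apply, Matrix.cons_val,
        pd_neg', hw1, hw2, pd_const', Fin.isValue] <;>
      generalize Real.sqrt (u 0 + u 1 * u 2 + 2 * (u 2) ^ 3) = q at * <;>
      rw [← hsq] <;>
      fin_cases l <;>
      simp [Fin.sum_univ_three, segC, segDS] <;>
      field_simp <;> (try rw [hu0]) <;> ring
  · intro m l p k
    rw [hinv, pd_const', zero_add]
    subst hw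
    dsimp only
    generalize Real.sqrt (u 0 + u 1 * u 2 + 2 * (u 2) ^ 3) = q at *
    rw [← hsq]
    fin_cases m <;> fin_cases l <;> fin_cases p <;> fin_cases k <;>
      simp [Fin.sum_univ_three, segC] <;> field_simp <;> ring
end

section
/- (Segre type [1(12)2]) Let n = 3 with coordinates (u¹,u²,u³), let λ > 0 be a real constant, define the symmetric metric g by g₁₁ = 1 + λ(u²)², g₁₂ = λ(−u¹u² + u³), g₁₃ = λu², g₂₂ = 4 + λ(u¹)², g₂₃ = −2λu¹, g₃₃ = λ, and let U = {u ∈ ℝ³ : det g(u) < 0}. Define c_{ijk} := (1/3)(∂_j g_{ik} − ∂_k g_{ij}) and the skew-symmetric field w by w₁₂ = λ^{3/2} u¹/√(−det g), w₂₃ = 0, w₃₁ = −λ^{3/2}/√(−det g) (with w_{ji} = −w_{ij}, w_{ii} = 0). Then (g, c, w) satisfies conditions (cond1) on U. -/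
open scoped BigOperators

namespace SegreAux

theorem pd_of {n : ℕ} {k : Fin n} {f : (Fin n → ℝ) → ℝ} {u : Fin n → ℝ}
    {f' : (Fin n → ℝ) →L[ℝ] ℝ} (h : HasFDerivAt f f' u) : pd k f u = f' (Pi.single k 1) := by
  rw [pd, h.fderiv]

theorem hcoord (i : Fin 3) (u : Fin 3 → ℝ) :
    HasFDerivAt (fun x : Fin 3 → ℝ => x i) (ContinuousLinearMap.proj (R := ℝ) i) u :=
  hasFDerivAt_apply i u

/-- The metric. -/
def G (l : ℝ) (u : Fin 3 → ℝ) : Matrix (Fin 3) (Fin 3) ℝ :=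
  !![1 + l * (u 1) ^ 2, l * (-(u 0 * u 1) + u 2), l * u 1;
     l * (-(u 0 * u 1) + u 2), 4 + l * (u 0) ^ 2, -(2 * l * u 0);
     l * u 1, -(2 * l * u 0), l]

/-- Partial derivatives of the metric, derivative index first. -/
def dG (l : ℝ) (u : Fin 3 → ℝ) : Fin 3 → Matrix (Fin 3) (Fin 3) ℝ :=
  ![!![0, -(l * u 1), 0; -(l * u 1), 2 * l * u 0, -(2 * l); 0, -(2 * l), 0],
    !![2 * l * u 1, -(l * u 0), l; -(l * u 0), 0, 0; l, 0, 0],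
    !![0, l, 0; l, 0, 0; 0, 0, 0]]

/-- The lowered coefficients. -/
def cc (l : ℝ) (u : Fin 3 → ℝ) : Fin 3 → Matrix (Fin 3) (Fin 3) ℝ :=
  ![!![0, -(l * u 1), 0; l * u 1, 0, 0; 0, 0, 0],
    !![0, l * u 0, -l; -(l * u 0), 0, 0; l, 0, 0],
    !![0, -l, 0; l, 0, 0; 0, 0, 0]]

/-- First basic skew matrix. -/
def E : Matrix (Fin 3) (Fin 3) ℝ := !![0, 1, 0; -1, 0, 0; 0, 0, 0]

/-- Second basic skew matrix. -/
def F : Matrix (Fin 3) (Fin 3) ℝ := !![0, 0, 1; 0, 0, 0; -1, 0, 0]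

/-- Coefficient of `E` in `cc`. -/
def P (l : ℝ) (u : Fin 3 → ℝ) : Fin 3 → ℝ := ![-(l * u 1), l * u 0, -l]

/-- Coefficient of `F` in `cc`. -/
def Q (l : ℝ) : Fin 3 → ℝ := ![0, -l, 0]

theorem cc_EF (l : ℝ) (u : Fin 3 → ℝ) (s i j : Fin 3) :
    cc l u s i j = P l u s * E i j + Q l s * F i j := by
  fin_cases s <;> fin_cases i <;> fin_cases j <;> simp [cc, P, Q, E, F]

/-- Partial derivatives of the lowered coefficients, derivative index first. -/
def dcc (l : ℝ) (k p i j : Fin 3) : ℝ := -l * E p k * E i j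

/-- The determinant of the metric. -/
def D (l : ℝ) (u : Fin 3 → ℝ) : ℝ :=
  l * (4 - 3 * l * (u 0) ^ 2 - l ^ 2 * (u 2 + u 0 * u 1) ^ 2)

/-- Partial derivatives of the determinant. -/
def dD (l : ℝ) (u : Fin 3 → ℝ) : Fin 3 → ℝ :=
  ![l * (-(6 * l * u 0) - 2 * l ^ 2 * (u 2 + u 0 * u 1) * u 1),
    -(2 * l ^ 3 * (u 2 + u 0 * u 1) * u 0),
    -(2 * l ^ 3 * (u 2 + u 0 * u 1))]

theorem pd_const (k : Fin 3) (a : ℝ) (u : Fin 3 → ℝ) : pd k (fun _ => a) u = 0 := by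
  simp [pd]

theorem det_G (l : ℝ) (u : Fin 3 → ℝ) : (G l u).det = D l u := by
  simp [G, D, Matrix.det_fin_three]; ring

theorem pd_G (l : ℝ) (u : Fin 3 → ℝ) (k i j : Fin 3) :
    pd k (fun x => G l x i j) u = dG l u k i j := by
  have h0 := hcoord 0 u
  have h1 := hcoord 1 u
  have h2 := hcoord 2 u
  have h00 := ((h0.pow 2).const_mul l).const_add 4
  have h11 := ((h1.pow 2).const_mul l).const_add 1
  have h01 := (((h0.mul h1).neg).add h2).const_mul l
  have h02 := h1.const_mul l
  have h12 := (h0.const_mul (2 * l)).neg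
  have e00 := pd_of (k := k) h11
  have e01 := pd_of (k := k) h01
  have e02 := pd_of (k := k) h02
  have e11 := pd_of (k := k) h00
  have e12 := pd_of (k := k) h12
  have e22 := pd_const k l u
  fin_cases i <;> fin_cases j
  · exact e00.trans (by fin_cases k <;> simp [dG] <;> try ring)
  · exact e01.trans (by fin_cases k <;> simp [dG] <;> try ring)
  · exact e02.trans (by fin_cases k <;> simp [dG] <;> try ring)
  · exact e01.trans (by fin_cases k <;> simp [dG] <;> try ring)
  · exact e11.trans (by fin_cases k <;> simp [dG] <;> try ring)
  · exact e12.trans (by fin_cases k <;> simp [dG] <;> try ring)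
  · exact e02.trans (by fin_cases k <;> simp [dG] <;> try ring)
  · exact e12.trans (by fin_cases k <;> simp [dG] <;> try ring)
  · exact e22.trans (by fin_cases k <;> simp [dG] <;> try ring)

theorem cc_eq (l : ℝ) (u : Fin 3 → ℝ) (i j k : Fin 3) :
    (1 / 3) * (dG l u j i k - dG l u k i j) = cc l u i j k := by
  fin_cases i <;> fin_cases j <;> fin_cases k <;> simp [dG, cc] <;> ring

theorem P_lin (l : ℝ) (x : Fin 3 → ℝ) (p : Fin 3) :
    P l x p = -l * E p 0 * x 0 + -l * E p 1 * x 1 + (![0, 0, -l] : Fin 3 → ℝ) p := by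
  fin_cases p <;> simp [P, E]

theorem cc_lin (l : ℝ) (x : Fin 3 → ℝ) (p i j : Fin 3) :
    cc l x p i j = dcc l 0 p i j * x 0 + dcc l 1 p i j * x 1 +
      ((![0, 0, -l] : Fin 3 → ℝ) p * E i j + Q l p * F i j) := by
  rw [cc_EF, P_lin, dcc, dcc]
  ring

theorem dcc_two (l : ℝ) (p i j : Fin 3) : dcc l 2 p i j = 0 := by
  fin_cases p <;> simp [dcc, E]

theorem pd_cc (l : ℝ) (u : Fin 3 → ℝ) (k p i j : Fin 3) :
    pd k (fun x => cc l x p i j) u = dcc l k p i j := by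
  have h := pd_of (k := k) ((((hcoord 0 u).const_mul (dcc l 0 p i j)).add
    ((hcoord 1 u).const_mul (dcc l 1 p i j))).add_const
    ((![0, 0, -l] : Fin 3 → ℝ) p * E i j + Q l p * F i j))
  simp only [cc_lin]
  refine Eq.trans h ?_
  have h2 := dcc_two l p i j
  generalize dcc l = d at *
  fin_cases k <;> simp [h2]

theorem hasD (l : ℝ) (u : Fin 3 → ℝ) :
    HasFDerivAt (D l) (∑ i, dD l u i • ContinuousLinearMap.proj (R := ℝ) (φ := fun _ => ℝ) i) u := by
  have h0 := hcoord 0 u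
  have h1 := hcoord 1 u
  have h2 := hcoord 2 u
  have h := ((((h0.pow 2).const_mul (3 * l)).const_sub 4).sub
    (((h2.add (h0.mul h1)).pow 2).const_mul (l ^ 2))).const_mul l
  refine HasFDerivAt.congr_fderiv h ?_
  ext v
  simp [dD, Fin.sum_univ_three]
  ring

/-- The reciprocal square root of minus the determinant. -/
noncomputable def S (l : ℝ) (u : Fin 3 → ℝ) : ℝ := (Real.sqrt (-(D l u)))⁻¹

theorem hasS (l : ℝ) (u : Fin 3 → ℝ) (hD : D l u < 0) :
    HasFDerivAt (S l) ((-(S l u) / (2 * D l u)) •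
      ∑ i, dD l u i • ContinuousLinearMap.proj (R := ℝ) (φ := fun _ => ℝ) i) u := by
  have hpos : 0 < -(D l u) := by linarith
  have hs : 0 < Real.sqrt (-(D l u)) := Real.sqrt_pos.mpr hpos
  have hsq : Real.sqrt (-(D l u)) ^ 2 = -(D l u) := Real.sq_sqrt hpos.le
  have h := ((hasDerivAt_inv hs.ne').comp_hasFDerivAt u ((hasD l u).neg.sqrt hpos.ne'))
  refine HasFDerivAt.congr_fderiv h ?_
  rw [smul_neg, smul_neg, smul_smul, ← neg_smul]
  congr 1
  rw [S, show D l u = -(Real.sqrt (-(D l u)) ^ 2) by rw [hsq]; ring]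
  rw [← hsq] at *
  simp only [neg_neg, Real.sqrt_sq hs.le]
  field_simp
  exact div_self (ne_of_gt hs)

/-- The skew form. -/
noncomputable def W (l : ℝ) (u : Fin 3 → ℝ) : Matrix (Fin 3) (Fin 3) ℝ :=
  !![0, l * Real.sqrt l * u 0 * S l u, l * Real.sqrt l * S l u;
     -(l * Real.sqrt l * u 0 * S l u), 0, 0;
     -(l * Real.sqrt l * S l u), 0, 0]

/-- Partial derivatives of the skew form divided by its scale factor. -/
noncomputable def dW (l : ℝ) (u : Fin 3 → ℝ) (k : Fin 3) : Matrix (Fin 3) (Fin 3) ℝ :=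
  let a := u 0 * (-(dD l u k) / (2 * D l u)) + (![1, 0, 0] : Fin 3 → ℝ) k
  let b := -(dD l u k) / (2 * D l u)
  !![0, a, b; -a, 0, 0; -b, 0, 0]

theorem pd_W (l : ℝ) (u : Fin 3 → ℝ) (hD : D l u < 0) (k i j : Fin 3) :
    pd k (fun x => W l x i j) u = l * Real.sqrt l * S l u * dW l u k i j := by
  have h0 := hcoord 0 u
  have hS := hasS l u hD
  have a := pd_of (k := k) ((h0.const_mul (l * Real.sqrt l)).mul hS)
  have a' := pd_of (k := k) ((h0.const_mul (l * Real.sqrt l)).mul hS).neg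
  have b := pd_of (k := k) (hS.const_mul (l * Real.sqrt l))
  have b' := pd_of (k := k) (hS.const_mul (l * Real.sqrt l)).neg
  have z := pd_const k 0 u
  fin_cases i <;> fin_cases j
  · exact z.trans (by fin_cases k <;> simp [dW, Fin.sum_univ_three] <;> ring)
  · exact a.trans (by fin_cases k <;> simp [dW, Fin.sum_univ_three] <;> ring)
  · exact b.trans (by fin_cases k <;> simp [dW, Fin.sum_univ_three] <;> ring)
  · exact a'.trans (by fin_cases k <;> simp [dW, Fin.sum_univ_three] <;> ring)
  · exact z.trans (by fin_cases k <;> simp [dW, Fin.sum_univ_three] <;> ring)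
  · exact z.trans (by fin_cases k <;> simp [dW, Fin.sum_univ_three] <;> ring)
  · exact b'.trans (by fin_cases k <;> simp [dW, Fin.sum_univ_three] <;> ring)
  · exact z.trans (by fin_cases k <;> simp [dW, Fin.sum_univ_three] <;> ring)
  · exact z.trans (by fin_cases k <;> simp [dW, Fin.sum_univ_three] <;> ring)

/-- The raised coefficients times the determinant. -/
noncomputable def A (l : ℝ) (u : Fin 3 → ℝ) (s : Fin 3) : Matrix (Fin 3) (Fin 3) ℝ :=
  ∑ a, (G l u).adjugate s a • cc l u a

theorem raise (l : ℝ) (u : Fin 3 → ℝ) (s i j : Fin 3) :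
    ∑ a, (G l u)⁻¹ s a * cc l u a i j = (D l u)⁻¹ * A l u s i j := by
  rw [A, Matrix.inv_def, det_G]
  simp only [Matrix.sum_apply, Matrix.smul_apply, smul_eq_mul, Finset.mul_sum,
    Ring.inverse_eq_inv', mul_assoc]

/-- Explicit form of `A`. -/
noncomputable def B (l : ℝ) (u : Fin 3 → ℝ) (s i j : Fin 3) : ℝ :=
  (∑ a, (G l u).adjugate s a * P l u a) * E i j + (∑ a, (G l u).adjugate s a * Q l a) * F i j

theorem A_eq (l : ℝ) (u : Fin 3 → ℝ) (s i j : Fin 3) : A l u s i j = B l u s i j := by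
  simp only [A, B, Matrix.sum_apply, Matrix.smul_apply, smul_eq_mul, cc_EF, Fin.sum_univ_three]
  ring

theorem five (l : ℝ) (u : Fin 3 → ℝ) (hD : D l u ≠ 0) (i j k : Fin 3) :
    l * Real.sqrt l * S l u * dW l u k i j = ∑ s, ((D l u)⁻¹ * B l u s i j) * W l u s k := by
  generalize hd : D l u = d at hD
  have hd' := hd
  simp only [D] at hd'
  fin_cases i <;> fin_cases j <;> fin_cases k <;>
    simp [dW, W, B, dD, P, Q, E, F, G, Matrix.adjugate_fin_three, Fin.sum_univ_three, hd] <;> field_simp <;> 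
    first | (ring; done) | (rw [← hd']; ring)

theorem six (l : ℝ) (hl : 0 < l) (u : Fin 3 → ℝ) (hD : D l u < 0) (m j p k : Fin 3) :
    dcc l k p m j + ∑ s, ((D l u)⁻¹ * B l u s m j) * cc l u s p k + W l u m j * W l u p k = 0 := by
  have hS : (l * Real.sqrt l * S l u) ^ 2 = - l ^ 3 / D l u := by
    rw [S, mul_pow, mul_pow, inv_pow, Real.sq_sqrt hl.le, Real.sq_sqrt (by linarith)]
    have := hD.ne
    field_simp
  have hW : ∀ a b, W l u a b = (l * Real.sqrt l * S l u) * (u 0 * E a b + F a b) := by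
    intro a b
    fin_cases a <;> fin_cases b <;> simp [W, E, F] <;> ring
  rw [hW, hW, mul_mul_mul_comm, ← pow_two, hS]
  have hD' := hD.ne
  simp only [cc_EF, B, dcc]
  generalize hd : D l u = d at hD'
  simp only [D] at hd
  generalize E m j = a
  generalize F m j = b
  generalize E p k = aa
  generalize F p k = bb
  simp [G, P, Q, Matrix.adjugate_fin_three, Fin.sum_univ_three]
  field_simp
  rw [← hd]
  ring

end SegreAux

/-- Segre type [1(12)2]. With `(u¹,u²,u³) = (u 0, u 1, u 2)`, `λ > 0`,
metric `g = !![1+λ(u²)², λ(−u¹u²+u³), λu²; λ(−u¹u²+u³), 4+λ(u¹)², −2λu¹; λu², −2λu¹, λ]`,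
`U = {u : det g(u) < 0}`, `c_{ijk} = (1/3)(∂_j g_{ik} − ∂_k g_{ij})` and the skew form
with `w₁₂ = λ^{3/2}u¹/√(−det g)`, `w₂₃ = 0`, `w₃₁ = −λ^{3/2}/√(−det g)`,
conditions (cond1) hold on `U`. -/
theorem segre_1122_third_satisfies_cond1 (l : ℝ) (hl : 0 < l)
    (g : (Fin 3 → ℝ) → Matrix (Fin 3) (Fin 3) ℝ)
    (hg : g = fun u => !![1 + l * (u 1) ^ 2, l * (-(u 0 * u 1) + u 2), l * u 1;
                          l * (-(u 0 * u 1) + u 2), 4 + l * (u 0) ^ 2, -(2 * l * u 0);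
                          l * u 1, -(2 * l * u 0), l])
    (U : Set (Fin 3 → ℝ)) (hU : U = {u | (g u).det < 0})
    (c : (Fin 3 → ℝ) → Fin 3 → Fin 3 → Fin 3 → ℝ)
    (hc : c = fun u i j k =>
      (1 / 3) * (pd j (fun x => g x i k) u - pd k (fun x => g x i j) u))
    (w : (Fin 3 → ℝ) → Matrix (Fin 3) (Fin 3) ℝ)
    (hw : w = fun u =>
      !![0, l * Real.sqrt l * u 0 / Real.sqrt (-(g u).det),
           l * Real.sqrt l / Real.sqrt (-(g u).det);
         -(l * Real.sqrt l * u 0 / Real.sqrt (-(g u).det)), 0, 0;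
         -(l * Real.sqrt l / Real.sqrt (-(g u).det)), 0, 0]) :
    Cond1 U g c w := by
  have hg' : g = SegreAux.G l := hg
  subst hg'
  have hc' : c = fun u i j k => SegreAux.cc l u i j k := by
    rw [hc]
    funext u i j k
    rw [SegreAux.pd_G, SegreAux.pd_G, SegreAux.cc_eq]
  subst hc'
  have hw' : w = SegreAux.W l := by
    rw [hw]
    funext u
    rw [SegreAux.det_G]
    simp only [SegreAux.W, SegreAux.S, div_eq_mul_inv]
  subst hw'
  intro u hu
  have hD : SegreAux.D l u < 0 := by
    rw [hU] at hu
    rw [← SegreAux.det_G]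
    exact hu
  refine ⟨?_, ?_, ?_, ?_, ?_, ?_⟩
  · intro i j k
    rw [SegreAux.pd_G]
    fin_cases i <;> fin_cases j <;> fin_cases k <;> simp [SegreAux.dG, SegreAux.cc] <;> ring
  · intro i j k
    fin_cases i <;> fin_cases j <;> fin_cases k <;> simp [SegreAux.cc]
  · intro i j k
    rw [SegreAux.pd_G, SegreAux.pd_G, SegreAux.pd_G]
    fin_cases i <;> fin_cases j <;> fin_cases k <;> simp [SegreAux.dG] <;> ring
  · intro i j
    fin_cases i <;> fin_cases j <;> simp [SegreAux.W]
  · intro i j k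
    rw [SegreAux.pd_W l u hD]
    simp only [SegreAux.raise, SegreAux.A_eq]
    exact SegreAux.five l u hD.ne i j k
  · intro m j p k
    rw [SegreAux.pd_cc]
    simp only [SegreAux.raise, SegreAux.A_eq]
    exact SegreAux.six l hl u hD m j p k
end

section
/- (Segre type [(11)112]) Let n = 3 with coordinates (u¹,u²,u³), let β, μ be real constants, define the symmetric metric g by g₁₁ = 1 + μ(u³)², g₁₂ = −2βu³, g₁₃ = βu² − μu¹u³, g₂₂ = μ, g₂₃ = βu¹, g₃₃ = μ(u¹)², and let U = {u ∈ ℝ³ : det g(u) ≠ 0 and β²(β² − μ²)/det g(u) > 0}. Define c_{ijk} := (1/3)(∂_j g_{ik} − ∂_k g_{ij}) and the skew-symmetric field w by w₁₂ = 0, w₂₃ = u¹·√(β²(β² − μ²)/det g), w₃₁ = u²·√(β²(β² − μ²)/det g) (with w_{ji} = −w_{ij}, w_{ii} = 0). Then (g, c, w) satisfies conditions (cond1) on U. -/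
open scoped BigOperators

namespace Segre

lemma pd_add {k : Fin 3} {f h : (Fin 3 → ℝ) → ℝ} {u : Fin 3 → ℝ}
    (hf : DifferentiableAt ℝ f u) (hh : DifferentiableAt ℝ h u) :
    pd k (fun x => f x + h x) u = pd k f u + pd k h u := by
  unfold pd; rw [fderiv_fun_add hf hh]; rfl

lemma pd_sub {k : Fin 3} {f h : (Fin 3 → ℝ) → ℝ} {u : Fin 3 → ℝ}
    (hf : DifferentiableAt ℝ f u) (hh : DifferentiableAt ℝ h u) :
    pd k (fun x => f x - h x) u = pd k f u - pd k h u := by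
  unfold pd; rw [fderiv_fun_sub hf hh]; rfl

lemma pd_neg {k : Fin 3} {f : (Fin 3 → ℝ) → ℝ} {u : Fin 3 → ℝ} :
    pd k (fun x => - f x) u = - pd k f u := by
  unfold pd; rw [fderiv_fun_neg]; rfl

lemma pd_mul {k : Fin 3} {f h : (Fin 3 → ℝ) → ℝ} {u : Fin 3 → ℝ}
    (hf : DifferentiableAt ℝ f u) (hh : DifferentiableAt ℝ h u) :
    pd k (fun x => f x * h x) u = f u * pd k h u + h u * pd k f u := by
  unfold pd; rw [fderiv_fun_mul hf hh]; simp

lemma pd_sq {k : Fin 3} {f : (Fin 3 → ℝ) → ℝ} {u : Fin 3 → ℝ}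
    (hf : DifferentiableAt ℝ f u) :
    pd k (fun x => f x ^ 2) u = 2 * f u * pd k f u := by
  simp only [pow_two]; rw [pd_mul hf hf]; ring

lemma pd_const {k : Fin 3} {a : ℝ} {u : Fin 3 → ℝ} :
    pd k (fun _ => a) u = 0 := by
  unfold pd; simp

lemma pd_coord {k i : Fin 3} {u : Fin 3 → ℝ} :
    pd k (fun x => x i) u = if i = k then 1 else 0 := by
  unfold pd
  rw [(hasFDerivAt_apply i u).fderiv]
  simp [Pi.single_apply]

/-- The determinant of the metric. -/
def D (b m : ℝ) (u : Fin 3 → ℝ) : ℝ :=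
  (1 + m * (u 2) ^ 2) * (m * (m * (u 0) ^ 2) - b * u 0 * (b * u 0))
    - (-(2 * b * u 2)) * (-(2 * b * u 2) * (m * (u 0) ^ 2) - b * u 0 * (b * u 1 - m * u 0 * u 2))
    + (b * u 1 - m * u 0 * u 2) * (-(2 * b * u 2) * (b * u 0) - m * (b * u 1 - m * u 0 * u 2))

/-- The metric. -/
def G (b m : ℝ) (u : Fin 3 → ℝ) : Matrix (Fin 3) (Fin 3) ℝ :=
  !![1 + m * (u 2) ^ 2, -(2 * b * u 2), b * u 1 - m * u 0 * u 2;
     -(2 * b * u 2), m, b * u 0;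
     b * u 1 - m * u 0 * u 2, b * u 0, m * (u 0) ^ 2]

/-- First derivatives of the metric. -/
def dG (b m : ℝ) (u : Fin 3 → ℝ) : Fin 3 → Matrix (Fin 3) (Fin 3) ℝ :=
  ![!![0, 0, -(m * u 2); 0, 0, b; -(m * u 2), b, 2 * m * u 0],
    !![0, 0, b; 0, 0, 0; b, 0, 0],
    !![2 * m * u 2, -(2 * b), -(m * u 0); -(2 * b), 0, 0; -(m * u 0), 0, 0]]

/-- Second derivatives of the metric. -/
def ddG (m : ℝ) (l k : Fin 3) : Matrix (Fin 3) (Fin 3) ℝ :=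
  !![if l = 2 ∧ k = 2 then 2 * m else 0, 0,
      if (l = 0 ∧ k = 2) ∨ (l = 2 ∧ k = 0) then -m else 0;
     0, 0, 0;
     if (l = 0 ∧ k = 2) ∨ (l = 2 ∧ k = 0) then -m else 0, 0,
      if l = 0 ∧ k = 0 then 2 * m else 0]

/-- The adjugate of the metric. -/
def A (b m : ℝ) (u : Fin 3 → ℝ) : Matrix (Fin 3) (Fin 3) ℝ := (G b m u).adjugate

/-- The polynomial part of the skew form. -/
def V (u : Fin 3 → ℝ) : Matrix (Fin 3) (Fin 3) ℝ :=
  !![0, 0, -(u 1); 0, 0, u 0; u 1, -(u 0), 0]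

/-- Derivatives of the polynomial part of the skew form. -/
def dV : Fin 3 → Matrix (Fin 3) (Fin 3) ℝ :=
  ![!![0, 0, 0; 0, 0, 1; 0, -1, 0], !![0, 0, -1; 0, 0, 0; 1, 0, 0],
    !![0, 0, 0; 0, 0, 0; 0, 0, 0]]

/-- The lowered coefficients. -/
noncomputable def C (b m : ℝ) (u : Fin 3 → ℝ) (i j k : Fin 3) : ℝ :=
  (1 / 3) * (dG b m u j i k - dG b m u k i j)

lemma det_G (b m : ℝ) (u : Fin 3 → ℝ) : (G b m u).det = D b m u := by
  simp [Matrix.det_fin_three, G, D]; ring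

lemma pd_G (b m : ℝ) (u : Fin 3 → ℝ) (i j k : Fin 3) :
    pd k (fun x => G b m x i j) u = dG b m u k i j := by
  fin_cases i <;> fin_cases j <;> fin_cases k <;>
    (try simp [G, dG]) <;>
    (try simp (disch := fun_prop) only [pd_add, pd_sub, pd_neg, pd_mul, pd_sq, pd_const, pd_coord]) <;>
    (try simp) <;> (try ring)

lemma diff_dG (b m : ℝ) (u : Fin 3 → ℝ) (i j k : Fin 3) :
    DifferentiableAt ℝ (fun x => dG b m x k i j) u := by
  fin_cases i <;> fin_cases j <;> fin_cases k <;> simp [dG] <;> fun_prop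

lemma pd_dG (b m : ℝ) (u : Fin 3 → ℝ) (i j k l : Fin 3) :
    pd l (fun x => dG b m x k i j) u = ddG m l k i j := by
  fin_cases i <;> fin_cases j <;> fin_cases k <;> fin_cases l <;>
    (try simp [dG, ddG]) <;>
    (try simp (disch := fun_prop) only [pd_add, pd_sub, pd_neg, pd_mul, pd_sq, pd_const, pd_coord]) <;>
    (try simp) <;> (try ring)

lemma pd_C (b m : ℝ) (u : Fin 3 → ℝ) (i j k l : Fin 3) :
    pd l (fun x => C b m x i j k) u = (1 / 3) * (ddG m l j i k - ddG m l k i j) := by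
  unfold C
  rw [pd_mul (by fun_prop) ((diff_dG ..).fun_sub (diff_dG ..)),
    pd_sub (diff_dG ..) (diff_dG ..), pd_dG, pd_dG, pd_const]
  ring

lemma pd_V (u : Fin 3 → ℝ) (i j l : Fin 3) :
    pd l (fun x => V x i j) u = dV l i j := by
  fin_cases i <;> fin_cases j <;> fin_cases l <;>
    (try simp [V, dV]) <;>
    (try simp (disch := fun_prop) only [pd_add, pd_sub, pd_neg, pd_mul, pd_sq, pd_const, pd_coord]) <;>
    (try simp) <;> (try ring)

lemma diff_V (u : Fin 3 → ℝ) (i j : Fin 3) :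
    DifferentiableAt ℝ (fun x => V x i j) u := by
  fin_cases i <;> fin_cases j <;> simp [V] <;> fun_prop

lemma diff_D (b m : ℝ) (u : Fin 3 → ℝ) : DifferentiableAt ℝ (D b m) u := by
  unfold D; fun_prop

/-- Gradient of the determinant. -/
def dD (b m : ℝ) (u : Fin 3 → ℝ) (k : Fin 3) : ℝ := ∑ i, ∑ j, A b m u i j * dG b m u k j i

lemma pd_D (b m : ℝ) (u : Fin 3 → ℝ) (k : Fin 3) :
    pd k (D b m) u = dD b m u k := by
  unfold D dD A G
  rw [Matrix.adjugate_fin_three_of]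
  simp (disch := fun_prop) only [pd_add, pd_sub, pd_neg, pd_mul, pd_sq, pd_const, pd_coord]
  fin_cases k <;> simp [dG, Fin.sum_univ_three] <;> ring

lemma key5 (b m : ℝ) (u : Fin 3 → ℝ) (i j l : Fin 3) :
    2 * D b m u * dV l i j - V u i j * dD b m u l
      = 2 * ∑ s, (∑ a, A b m u s a * C b m u a i j) * V u s l := by
  unfold D dD A G C
  rw [Matrix.adjugate_fin_three_of]
  fin_cases i <;> fin_cases j <;> fin_cases l <;>
    simp [dG, dV, V, Fin.sum_univ_three] <;> ring

lemma key6 (b m : ℝ) (u : Fin 3 → ℝ) (i j p k : Fin 3) :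
    D b m u * ((1 / 3) * (ddG m k i p j - ddG m k j p i))
      + ∑ s, (∑ a, A b m u s a * C b m u a i j) * C b m u s p k
      + b ^ 2 * (b ^ 2 - m ^ 2) * (V u i j * V u p k) = 0 := by
  unfold D A G C
  rw [Matrix.adjugate_fin_three_of]
  fin_cases i <;> fin_cases j <;> fin_cases p <;> fin_cases k <;>
    simp [dG, ddG, V, Fin.sum_univ_three] <;> ring

/-- The square root factor. -/
noncomputable def S (b m : ℝ) (u : Fin 3 → ℝ) : ℝ :=
  Real.sqrt (b ^ 2 * (b ^ 2 - m ^ 2) / D b m u)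

lemma hasFDerivAt_S (b m : ℝ) (u : Fin 3 → ℝ) (h0 : D b m u ≠ 0)
    (h : 0 < b ^ 2 * (b ^ 2 - m ^ 2) / D b m u) :
    HasFDerivAt (S b m) ((-(S b m u) / (2 * D b m u)) • fderiv ℝ (D b m) u) u := by
  have hS : S b m u ≠ 0 := (Real.sqrt_pos.2 h).ne'
  have hSS : S b m u ^ 2 = b ^ 2 * (b ^ 2 - m ^ 2) / D b m u := Real.sq_sqrt h.le
  have h1 : HasDerivAt (fun t : ℝ => Real.sqrt (b ^ 2 * (b ^ 2 - m ^ 2) / t))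
      (-(S b m u) / (2 * D b m u)) (D b m u) := by
    have h2 := (((hasDerivAt_inv h0).const_mul (b ^ 2 * (b ^ 2 - m ^ 2))).sqrt
      (by rw [← div_eq_mul_inv]; exact h.ne'))
    simp only [← div_eq_mul_inv] at h2
    convert h2 using 1
    change _ = _ / (2 * S b m u)
    have hK : b ^ 2 * (b ^ 2 - m ^ 2) = S b m u ^ 2 * D b m u := by
      rw [hSS]; field_simp
    rw [hK]
    field_simp
  exact h1.comp_hasFDerivAt u (diff_D b m u).hasFDerivAt

lemma pd_S (b m : ℝ) (u : Fin 3 → ℝ) (h0 : D b m u ≠ 0)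
    (h : 0 < b ^ 2 * (b ^ 2 - m ^ 2) / D b m u) (k : Fin 3) :
    pd k (S b m) u = -(S b m u) / (2 * D b m u) * dD b m u k := by
  rw [← pd_D]; unfold pd
  rw [(hasFDerivAt_S b m u h0 h).fderiv]; simp

lemma inv_G (b m : ℝ) (u : Fin 3 → ℝ) (i j : Fin 3) :
    (G b m u)⁻¹ i j = (D b m u)⁻¹ * A b m u i j := by
  rw [Matrix.inv_def, det_G]; simp [A]

lemma sum_inv (b m : ℝ) (u : Fin 3 → ℝ) (x y : Fin 3 → ℝ) :
    ∑ s, (∑ a, (G b m u)⁻¹ s a * x a) * y s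
      = (D b m u)⁻¹ * ∑ s, (∑ a, A b m u s a * x a) * y s := by
  simp only [inv_G, Fin.sum_univ_three]; ring

lemma main (b m : ℝ) (u : Fin 3 → ℝ) (h0 : D b m u ≠ 0)
    (h : 0 < b ^ 2 * (b ^ 2 - m ^ 2) / D b m u) :
    (∀ i j k, pd k (fun x => G b m x i j) u + C b m u i j k + C b m u j i k = 0) ∧
    (∀ i j k, C b m u i j k + C b m u i k j = 0) ∧
    (∀ i j k, pd k (fun x => G b m x i j) u + pd i (fun x => G b m x j k) u
        + pd j (fun x => G b m x k i) u = 0) ∧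
    (∀ i j, V u i j * S b m u + V u j i * S b m u = 0) ∧
    (∀ i j l, pd l (fun x => V x i j * S b m x) u
        = ∑ s, (∑ a, (G b m u)⁻¹ s a * C b m u a i j) * (V u s l * S b m u)) ∧
    (∀ i j p k, pd k (fun x => C b m x p i j) u
        + ∑ s, (∑ a, (G b m u)⁻¹ s a * C b m u a i j) * C b m u s p k
        + (V u i j * S b m u) * (V u p k * S b m u) = 0) := by
  refine ⟨?_, ?_, ?_, ?_, ?_, ?_⟩
  · intro i j k
    rw [pd_G]
    fin_cases i <;> fin_cases j <;> fin_cases k <;> simp [C, dG] <;> ring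
  · intro i j k
    unfold C; ring
  · intro i j k
    simp only [pd_G]
    fin_cases i <;> fin_cases j <;> fin_cases k <;> simp [dG] <;> ring
  · intro i j
    fin_cases i <;> fin_cases j <;> simp [V]
  · intro i j l
    rw [pd_mul (diff_V u i j) (hasFDerivAt_S b m u h0 h).differentiableAt, pd_V]
    change V u i j * pd l (S b m) u + _ = _
    rw [pd_S b m u h0 h, sum_inv b m u (fun a => C b m u a i j) (fun s => V u s l * S b m u)]
    simp only [← mul_assoc, ← Finset.sum_mul]
    have := key5 b m u i j l
    have e : ∑ s, (∑ a, A b m u s a * C b m u a i j) * V u s l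
      = (2 * D b m u * dV l i j - V u i j * dD b m u l) / 2 := by linarith
    rw [mul_assoc, e]
    field_simp
    ring
  · intro i j p k
    rw [pd_C, sum_inv b m u (fun a => C b m u a i j) (fun s => C b m u s p k)]
    have hSS : S b m u ^ 2 = b ^ 2 * (b ^ 2 - m ^ 2) / D b m u := Real.sq_sqrt h.le
    have e : V u i j * S b m u * (V u p k * S b m u)
        = (b ^ 2 * (b ^ 2 - m ^ 2) / D b m u) * (V u i j * V u p k) := by
      rw [← hSS]; ring
    rw [e]
    have := key6 b m u i j p k
    have e2 : ∑ s, (∑ a, A b m u s a * C b m u a i j) * C b m u s p k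
      = -(D b m u * ((1 / 3) * (ddG m k i p j - ddG m k j p i))
        + b ^ 2 * (b ^ 2 - m ^ 2) * (V u i j * V u p k)) := by linarith
    rw [e2]
    field_simp
    ring

end Segre

/-- Segre type [(11)112]. With `(u¹,u²,u³) = (u 0, u 1, u 2)`, `β μ : ℝ`,
metric as indicated, `U = {u : det g(u) ≠ 0 ∧ β²(β²−μ²)/det g(u) > 0}`,
`c_{ijk} = (1/3)(∂_j g_{ik} − ∂_k g_{ij})` and the skew form with `w₁₂ = 0`,
`w₂₃ = u¹√(β²(β²−μ²)/det g)`, `w₃₁ = u²√(β²(β²−μ²)/det g)`,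
conditions (cond1) hold on `U`. -/
theorem segre_11112_second_satisfies_cond1 (b m : ℝ)
    (g : (Fin 3 → ℝ) → Matrix (Fin 3) (Fin 3) ℝ)
    (hg : g = fun u =>
      !![1 + m * (u 2) ^ 2, -(2 * b * u 2), b * u 1 - m * u 0 * u 2;
         -(2 * b * u 2), m, b * u 0;
         b * u 1 - m * u 0 * u 2, b * u 0, m * (u 0) ^ 2])
    (U : Set (Fin 3 → ℝ))
    (hU : U = {u | (g u).det ≠ 0 ∧ 0 < b ^ 2 * (b ^ 2 - m ^ 2) / (g u).det})
    (c : (Fin 3 → ℝ) → Fin 3 → Fin 3 → Fin 3 → ℝ)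
    (hc : c = fun u i j k =>
      (1 / 3) * (pd j (fun x => g x i k) u - pd k (fun x => g x i j) u))
    (w : (Fin 3 → ℝ) → Matrix (Fin 3) (Fin 3) ℝ)
    (hw : w = fun u =>
      !![0, 0, -(u 1 * Real.sqrt (b ^ 2 * (b ^ 2 - m ^ 2) / (g u).det));
         0, 0, u 0 * Real.sqrt (b ^ 2 * (b ^ 2 - m ^ 2) / (g u).det);
         u 1 * Real.sqrt (b ^ 2 * (b ^ 2 - m ^ 2) / (g u).det),
           -(u 0 * Real.sqrt (b ^ 2 * (b ^ 2 - m ^ 2) / (g u).det)), 0]) :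
    Cond1 U g c w := by
  have hg' : g = Segre.G b m := by rw [hg]; rfl
  have hc' : c = Segre.C b m := by
    rw [hc, hg']; funext u i j k
    simp only [Segre.pd_G]; rfl
  have hw' : w = fun u => Matrix.of fun i j => Segre.V u i j * Segre.S b m u := by
    rw [hw, hg']; funext u
    simp only [Segre.det_G]
    ext i j
    fin_cases i <;> fin_cases j <;> simp [Segre.V, Segre.S]
  clear hg hc hw
  subst hg' hc' hw' hU
  intro u hu
  simp only [Set.mem_setOf_eq, Segre.det_G] at hu
  exact Segre.main b m u hu.1 hu.2
end
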